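/- arXiv:2101.04955 — 9 statements merged into one kernel-verified Lean document; each statement's English description precedes it below -/
import Mathlib

section
/- Let n be an integer with 3 ≤ n ≤ 9. Then there is no ℓ ∈ K_o(n) with F(ℓ) > 0; equivalently, F(ℓ) ≤ 0 for every ℓ ∈ K_o(n). -/
/-- The inequality in terms of the smallest entry `p`, the two largest entries `q ≤ r`, and the
sum `U` and the sum of squares `V` of the remaining `m ≤ 6` entries, which lie in `[p, q]`. -/
theorem kasner_quiescence_nonpos_of_sums {m p q r U V : ℝ} (hm0 : 0 ≤ m) (hm6 : m ≤ 6)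
    (hpq : p ≤ q) (hqr : q ≤ r)
    (hU : U - m * p ≤ m * (q - p))
    (hV : V - 2 * p * U + m * p ^ 2 ≤ (q - p) * (U - m * p))
    (hsum : p + U + q + r = 1) (hsq : p ^ 2 + V + q ^ 2 + r ^ 2 = 1) :
    p - q - r + 1 ≤ 0 := by
  by_contra! hg
  obtain ⟨a, rfl⟩ : ∃ a, q = p + a := ⟨q - p, by ring⟩
  obtain ⟨b, rfl⟩ : ∃ b, r = p + b := ⟨r - p, by ring⟩
  obtain ⟨R, rfl⟩ : ∃ R, U = m * p + R := ⟨U - m * p, by ring⟩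
  obtain ⟨T, rfl⟩ : ∃ T, V = T + 2 * p * R + m * p ^ 2 := ⟨V - 2 * p * R - m * p ^ 2, by ring⟩
  obtain ⟨g, hgdef⟩ : ∃ g, g = (m + 2) * p + R := ⟨_, rfl⟩
  have hgpos : 0 < g := by linarith
  have ha : 0 ≤ a := by linarith
  have hab : a ≤ b := by linarith
  have hR : R ≤ m * a := by linarith
  have hT : T ≤ a * R := by linarith
  have key : (m + 3) * g ^ 2 + 2 * g * ((m + 2) * (a + b) - R) + R ^ 2
      + (m + 2) * (2 * a * b - T) = 0 := by
    have h : (p + (m * p + R) + (p + a) + (p + b)) ^ 2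
        - (p ^ 2 + (T + 2 * p * R + m * p ^ 2) + (p + a) ^ 2 + (p + b) ^ 2) = 0 := by
      rw [hsum, hsq]; norm_num
    subst hgdef
    linear_combination (m + 2) * h
  have h1 : 0 < (m + 3) * g ^ 2 := by positivity
  have h2 : 0 ≤ 2 * g * ((m + 2) * (a + b) - R) := by
    refine mul_nonneg (by positivity) ?_
    nlinarith [mul_nonneg hm0 (ha.trans hab)]
  have h3 : (m + 2) * (2 * a ^ 2 - a * R) ≤ (m + 2) * (2 * a * b - T) := by
    refine mul_le_mul_of_nonneg_left ?_ (by linarith)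
    nlinarith
  have h4 : 0 ≤ R ^ 2 + (m + 2) * (2 * a ^ 2 - a * R) := by
    have h5 : 0 ≤ (m + 2) * (6 - m) * a ^ 2 :=
      mul_nonneg (mul_nonneg (by linarith) (by linarith)) (sq_nonneg a)
    nlinarith [sq_nonneg (2 * R - (m + 2) * a)]
  linarith

/-- A sum over `Fin (m + 3)` with the first and the last two terms split off. -/
theorem Fin.sum_univ_eq_first_add_middle_add_last_two {m : ℕ} (f : Fin (m + 3) → ℝ) :
    ∑ i, f i = f ⟨0, by omega⟩ + ∑ i : Fin m, f ⟨i + 1, by omega⟩ + f ⟨m + 3 - 2, by omega⟩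
      + f ⟨m + 3 - 1, by omega⟩ := by
  rw [Fin.sum_univ_castSucc, Fin.sum_univ_castSucc, Fin.sum_univ_succ]
  rfl

/-- For `3 ≤ n ≤ 9`, there is no element of the Kasner set `K_o(n)` (nondecreasing
vectors satisfying the two Kasner relations) with `F(ℓ) = ℓ₁ - ℓ_{n-1} - ℓ_n + 1 > 0`;
equivalently `F(ℓ) ≤ 0` on `K_o(n)`. -/
theorem kasner_no_quiescent_vacuum_low_dim
    (n : ℕ) (hn3 : 3 ≤ n) (hn9 : n ≤ 9) (ℓ : Fin n → ℝ)
    (hmono : Monotone ℓ)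
    (hsum : ∑ i, ℓ i = 1)
    (hsq : ∑ i, (ℓ i) ^ 2 = 1) :
    ℓ ⟨0, by omega⟩ - ℓ ⟨n - 2, by omega⟩ - ℓ ⟨n - 1, by omega⟩ + 1 ≤ 0 := by
  obtain ⟨m, rfl⟩ : ∃ m, n = m + 3 := ⟨n - 3, by omega⟩
  rw [Fin.sum_univ_eq_first_add_middle_add_last_two] at hsum hsq
  set p := ℓ ⟨0, by omega⟩
  set q := ℓ ⟨m + 3 - 2, by omega⟩
  have hp (i : Fin m) : p ≤ ℓ ⟨i + 1, by omega⟩ := hmono (by simp)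
  have hq (i : Fin m) : ℓ ⟨i + 1, by omega⟩ ≤ q := hmono (by simp only [Fin.mk_le_mk]; omega)
  refine kasner_quiescence_nonpos_of_sums (m := m) (by positivity)
    (by exact_mod_cast (by omega : m ≤ 6)) (hmono (by simp))
    (hmono (by simp only [Fin.mk_le_mk]; omega)) ?_ ?_ hsum hsq
  · have h := Finset.sum_le_sum fun i (_ : i ∈ Finset.univ) => hq i
    simp only [Finset.sum_const, Finset.card_univ, Fintype.card_fin, nsmul_eq_mul] at h
    linarith
  · have h : 0 ≤ ∑ i : Fin m, (ℓ ⟨i + 1, by omega⟩ - p) * (q - ℓ ⟨i + 1, by omega⟩) :=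
      Finset.sum_nonneg fun i _ => mul_nonneg (sub_nonneg.2 (hp i)) (sub_nonneg.2 (hq i))
    have expand (x : ℝ) : (x - p) * (q - x) = (p + q) * x - x ^ 2 - p * q := by ring
    simp only [expand, Finset.sum_sub_distrib, ← Finset.mul_sum, Finset.sum_const,
      Finset.card_univ, Fintype.card_fin, nsmul_eq_mul] at h
    linarith
end

section
/- Let n be an integer with n ≥ 10. Then there exists ℓ ∈ K_o(n) with F(ℓ) > 0. -/
/-- A sum over `m + 10` indices of a function which is constant on the first three and on the last
seven indices, and zero in between. -/
theorem sum_three_zeros_seven (m : ℕ) (x y : ℝ) :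
    ∑ i : Fin (m + 10), (if (i : ℕ) < 3 then x else if (i : ℕ) < m + 3 then 0 else y) =
      3 * x + 7 * y := by
  rw [Fin.sum_univ_eq_sum_range
    (fun i : ℕ => if i < 3 then x else if i < m + 3 then 0 else y) (m + 10),
    show m + 10 = 3 + m + 7 by ring, Finset.sum_range_add, Finset.sum_range_add]
  have h_mid : ∑ i ∈ Finset.range m,
      (if 3 + i < 3 then x else if 3 + i < m + 3 then 0 else y) = 0 := by
    refine Finset.sum_eq_zero fun i hi => ?_
    have := Finset.mem_range.mp hi
    rw [if_neg (by omega), if_pos (by omega)]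
  have h_last : ∑ i ∈ Finset.range 7,
      (if 3 + m + i < 3 then x else if 3 + m + i < m + 3 then 0 else y) = 7 * y := by
    rw [Finset.sum_congr rfl fun i _ => by rw [if_neg (by omega), if_neg (by omega)]]
    simp
  have h_first : ∑ i ∈ Finset.range 3,
      (if i < 3 then x else if i < m + 3 then 0 else y) = 3 * x := by
    rw [Finset.sum_congr rfl fun i hi => by rw [if_pos (Finset.mem_range.mp hi)]]
    simp
  rw [h_mid, h_last, h_first, add_zero]

/-- For `n ≥ 10`, there exists an element of the Kasner set `K_o(n)` (nondecreasing
vectors satisfying the two Kasner relations) with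
`F(ℓ) = ℓ₁ - ℓ_{n-1} - ℓ_n + 1 > 0`. -/
theorem kasner_quiescent_vacuum_high_dim (n : ℕ) (hn : 10 ≤ n) :
    ∃ ℓ : Fin n → ℝ, Monotone ℓ ∧ (∑ i, ℓ i = 1) ∧ (∑ i, (ℓ i) ^ 2 = 1) ∧
      0 < ℓ ⟨0, by omega⟩ - ℓ ⟨n - 2, by omega⟩ - ℓ ⟨n - 1, by omega⟩ + 1 := by
  obtain ⟨m, rfl⟩ := Nat.exists_eq_add_of_le' hn
  obtain ⟨a, ha, ha₀, ha₁⟩ : ∃ a : ℝ, 5 * a ^ 2 + a - 1 = 0 ∧ 0 < a ∧ a < 5 / 13 := by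
    have hs : √(21 : ℝ) ^ 2 = 21 := Real.sq_sqrt (by norm_num)
    have hs₀ : 0 ≤ √(21 : ℝ) := Real.sqrt_nonneg _
    exact ⟨(√21 - 1) / 10, by nlinarith, by nlinarith, by nlinarith⟩
  refine ⟨fun i => if (i : ℕ) < 3 then -a else if (i : ℕ) < m + 3 then 0 else (1 + 3 * a) / 7,
    ?_, ?_, ?_, ?_⟩
  · intro i j hij
    have hij' : (i : ℕ) ≤ j := hij
    dsimp only
    split_ifs <;> first | omega | linarith
  · rw [sum_three_zeros_seven]
    ring
  · simp only [ite_pow, ne_eq, OfNat.ofNat_ne_zero, not_false_eq_true, zero_pow]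
    rw [sum_three_zeros_seven]
    linear_combination 6 / 7 * ha
  · dsimp only
    rw [if_pos (by omega), if_neg (by omega), if_neg (by omega), if_neg (by omega),
      if_neg (by omega)]
    linarith
end

section
/- The vector ℓ ∈ ℝ¹⁰ whose first three entries equal (1 − √21)/10 and whose last seven entries equal (1 + √(27/7))/10 belongs to K_o(10), and F(ℓ) = (9 − √21 − 2√(27/7))/10 > 0. -/
/-- The vector in `ℝ¹⁰` whose first three entries equal `(1 - √21)/10` and whose last
seven entries equal `(1 + √(27/7))/10` belongs to `K_o(10)`, and
`F(ℓ) = (9 - √21 - 2√(27/7))/10 > 0`. -/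
theorem kasner_ten_dim_example (ℓ : Fin 10 → ℝ)
    (hℓ : ℓ = fun i : Fin 10 => if (i : ℕ) < 3 then (1 - Real.sqrt 21) / 10
      else (1 + Real.sqrt (27 / 7)) / 10) :
    Monotone ℓ ∧ (∑ i, ℓ i = 1) ∧ (∑ i, (ℓ i) ^ 2 = 1) ∧
      ℓ 0 - ℓ 8 - ℓ 9 + 1 = (9 - Real.sqrt 21 - 2 * Real.sqrt (27 / 7)) / 10 ∧
      0 < (9 - Real.sqrt 21 - 2 * Real.sqrt (27 / 7)) / 10 := by
  have hs : Real.sqrt (27 / 7) = 3 / 7 * Real.sqrt 21 := by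
    rw [show (27 / 7 : ℝ) = (3 / 7) ^ 2 * 21 by norm_num, Real.sqrt_mul (by positivity),
      Real.sqrt_sq (by norm_num)]
  have hsq : Real.sqrt 21 ^ 2 = 21 := Real.sq_sqrt (by norm_num)
  have hnonneg : 0 ≤ Real.sqrt 21 := Real.sqrt_nonneg 21
  have hlt : Real.sqrt 21 < 23 / 5 := by
    rw [Real.sqrt_lt' (by norm_num)]
    norm_num
  rw [hs] at hℓ ⊢
  subst hℓ
  refine ⟨fun i j hij => ?_, ?_, ?_, ?_, by linarith⟩
  · have hval : (i : ℕ) ≤ (j : ℕ) := hij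
    dsimp only
    split_ifs
    · exact le_rfl
    · linarith
    · omega
    · exact le_rfl
  · simp [Fin.sum_univ_succ]
    ring
  · simp [Fin.sum_univ_succ]
    linear_combination (3 / 70) * hsq
  · simp
    ring
end

section
/- Let n ≥ 3 be an integer and suppose ℓ ∈ K_o(n) maximizes F on K_o(n), i.e. F(ℓ) ≥ F(ℓ') for all ℓ' ∈ K_o(n). Then the set of values {ℓ₁, …, ℓ_n} consists of exactly two distinct real numbers. -/
/-- The Kasner set `K_o(n)`: nondecreasing vectors `ℓ ∈ ℝⁿ` satisfying the
Kasner relations `∑ ℓ_A = 1` and `∑ ℓ_A² = 1`. -/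
def KasnerSet (n : ℕ) : Set (Fin n → ℝ) :=
  {ℓ | Monotone ℓ ∧ (∑ i, ℓ i) = 1 ∧ (∑ i, (ℓ i) ^ 2) = 1}

/-- A nonzero trace-free nondecreasing vector, rescaled to have squared norm `1 - 1 / n` and
shifted by `1 / n`, satisfies the Kasner relations. -/
lemma mem_kasnerSet_of_trace_free {n : ℕ} (hn : 0 < n) {q : Fin n → ℝ} (hq : Monotone q)
    (hsum : ∑ i, q i = 0) {r s : ℝ} (hr : 0 ≤ r) (hs : 0 < s) (hr2 : r ^ 2 = 1 - 1 / n)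
    (hs2 : ∑ i, q i ^ 2 = s ^ 2) : (fun i => 1 / (n : ℝ) + r / s * q i) ∈ KasnerSet n := by
  have hn' : (n : ℝ) ≠ 0 := by positivity
  refine ⟨fun i j hij => ?_, ?_, ?_⟩
  · have := mul_le_mul_of_nonneg_left (hq hij) (div_nonneg hr hs.le)
    simpa using this
  · rw [Finset.sum_add_distrib, ← Finset.mul_sum, hsum]
    simp [hn']
  · have key : ∀ i, (1 / (n : ℝ) + r / s * q i) ^ 2 =
        1 / (n : ℝ) ^ 2 + 2 / n * (r / s) * q i + (r / s) ^ 2 * q i ^ 2 := fun i => by ring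
    simp only [key]
    rw [Finset.sum_add_distrib, Finset.sum_add_distrib, ← Finset.mul_sum, ← Finset.mul_sum,
      hsum, hs2, div_pow, div_mul_cancel₀ _ (by positivity), hr2]
    simp only [Finset.sum_const, Finset.card_univ, Fintype.card_fin, nsmul_eq_mul]
    field_simp
    ring

/-- The norm of a sum of two vectors is strictly smaller than the sum of the norms if the first
vector takes equal values at two indices where the second does not. -/
lemma norm_lt_add_of_ne {ι : Type*} [Fintype ι] {u w : ι → ℝ} {r s t : ℝ}
    (hs : 0 < s) (ht : 0 < t) (hr2 : ∑ i, (u i + w i) ^ 2 = r ^ 2)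
    (hs2 : ∑ i, u i ^ 2 = s ^ 2) (ht2 : ∑ i, w i ^ 2 = t ^ 2) {j k : ι}
    (hu : u j = u k) (hw : w j ≠ w k) : r < s + t := by
  have hpos : 0 < ∑ i, (t * u i - s * w i) ^ 2 := by
    refine lt_of_le_of_ne (Finset.sum_nonneg fun i _ => sq_nonneg _) fun h0 => hw ?_
    have hz := (Finset.sum_eq_zero_iff_of_nonneg fun i _ => sq_nonneg _).1 h0.symm
    have hj := pow_eq_zero_iff two_ne_zero |>.1 (hz j (Finset.mem_univ j))
    have hk := pow_eq_zero_iff two_ne_zero |>.1 (hz k (Finset.mem_univ k))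
    rw [hu] at hj
    exact mul_left_cancel₀ hs.ne' (by linarith)
  have e1 : ∑ i, (t * u i - s * w i) ^ 2 =
      t ^ 2 * s ^ 2 + s ^ 2 * t ^ 2 - 2 * s * t * ∑ i, u i * w i := by
    rw [← hs2, Finset.mul_sum, hs2, ← ht2, Finset.mul_sum, ht2, Finset.mul_sum,
      ← Finset.sum_add_distrib, ← Finset.sum_sub_distrib]
    exact Finset.sum_congr rfl fun i _ => by ring
  have e2 : r ^ 2 = s ^ 2 + t ^ 2 + 2 * ∑ i, u i * w i := by
    rw [← hr2, ← hs2, ← ht2, Finset.mul_sum, ← Finset.sum_add_distrib,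
      ← Finset.sum_add_distrib]
    exact Finset.sum_congr rfl fun i _ => by ring
  have hlt : ∑ i, u i * w i < s * t := by
    have h2 : 0 < 2 * (s * t) * (s * t - ∑ i, u i * w i) := by rw [e1] at hpos; linarith
    linarith [(mul_pos_iff_of_pos_left (by positivity)).1 h2]
  exact lt_of_pow_lt_pow_left₀ 2 (by positivity) (by rw [e2]; linarith [add_sq s t])

lemma exists_norm_pos_of_ne {ι : Type*} [Fintype ι] {u : ι → ℝ} {j k : ι} (h : u j ≠ u k) :
    ∃ s : ℝ, 0 < s ∧ ∑ i, u i ^ 2 = s ^ 2 := by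
  have hnn : 0 ≤ ∑ i, u i ^ 2 := Finset.sum_nonneg fun i _ => sq_nonneg _
  refine ⟨√(∑ i, u i ^ 2), Real.sqrt_pos.2 (lt_of_le_of_ne hnn fun h0 => h ?_),
    (Real.sq_sqrt hnn).symm⟩
  have hz := (Finset.sum_eq_zero_iff_of_nonneg fun i _ => sq_nonneg _).1 h0.symm
  rw [pow_eq_zero_iff two_ne_zero |>.1 (hz j (Finset.mem_univ j)),
    pow_eq_zero_iff two_ne_zero |>.1 (hz k (Finset.mem_univ k))]

lemma sum_sub_mean_eq_zero {n : ℕ} (hn : 0 < n) (f : Fin n → ℝ) :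
    ∑ i, (f i - (∑ j, f j) / n) = 0 := by
  have hn' : (n : ℝ) ≠ 0 := by positivity
  rw [Finset.sum_sub_distrib]
  simp [mul_div_cancel₀, hn']

/-- If `n ≥ 3` and `ℓ ∈ K_o(n)` maximizes `F(ℓ) = ℓ₁ - ℓ_{n-1} - ℓ_n + 1` on `K_o(n)`,
then the set of values `{ℓ₁, …, ℓ_n}` consists of exactly two distinct real numbers. -/
theorem kasner_maximizer_two_values (n : ℕ) (hn : 3 ≤ n) (ℓ : Fin n → ℝ)
    (hmem : ℓ ∈ KasnerSet n)
    (hmax : ∀ ℓ' ∈ KasnerSet n,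
      ℓ' ⟨0, by omega⟩ - ℓ' ⟨n - 2, by omega⟩ - ℓ' ⟨n - 1, by omega⟩ + 1 ≤
        ℓ ⟨0, by omega⟩ - ℓ ⟨n - 2, by omega⟩ - ℓ ⟨n - 1, by omega⟩ + 1) :
    ∃ a b : ℝ, a ≠ b ∧ Set.range ℓ = {a, b} := by
  obtain ⟨hmono, h1, h2⟩ := hmem
  have hn0 : 0 < n := by omega
  have hn3 : (3 : ℝ) ≤ n := by exact_mod_cast hn
  set z : Fin n := ⟨0, by omega⟩
  set y : Fin n := ⟨n - 2, by omega⟩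
  set x : Fin n := ⟨n - 1, by omega⟩ with hx
  have hzle : ∀ i, ℓ z ≤ ℓ i := fun i => hmono (Fin.le_def.2 (Nat.zero_le _))
  have hlex : ∀ i, ℓ i ≤ ℓ x := fun i => hmono (Fin.le_def.2 (by simp only [hx]; omega))
  have hmax_gt : 1 / (n : ℝ) < ℓ x := by
    by_contra! hle
    have heq : ∀ i ∈ Finset.univ, ℓ i = 1 / (n : ℝ) := by
      refine (Finset.sum_eq_sum_iff_of_le fun i _ => (hlex i).trans hle).1 ?_
      rw [h1]
      simp [show (n : ℝ) ≠ 0 by positivity]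
    rw [Finset.sum_congr rfl fun i hi => by rw [heq i hi]] at h2
    simp only [Finset.sum_const, Finset.card_univ, Fintype.card_fin, nsmul_eq_mul] at h2
    field_simp at h2
    linarith
  have hne : ℓ z ≠ ℓ x := fun h => by
    have hc : ∀ i, ℓ i = ℓ x := fun i => le_antisymm (hlex i) (h ▸ hzle i)
    rw [Finset.sum_congr rfl fun i _ => hc i] at h1
    simp only [Finset.sum_const, Finset.card_univ, Fintype.card_fin, nsmul_eq_mul] at h1
    rw [div_lt_iff₀ (by positivity)] at hmax_gt
    linarith
  refine ⟨ℓ z, ℓ x, hne, ?_⟩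
  by_contra hrange
  obtain ⟨m, hmz, hmx⟩ : ∃ m, ℓ m ≠ ℓ z ∧ ℓ m ≠ ℓ x := by
    by_contra! hcon
    refine hrange (Set.Subset.antisymm ?_ ?_)
    · rintro _ ⟨i, rfl⟩
      by_cases hi : ℓ i = ℓ z
      · exact Or.inl hi
      · exact Or.inr (hcon i hi)
    · rintro _ (rfl | rfl)
      exacts [⟨z, rfl⟩, ⟨x, rfl⟩]
  have hzm : ℓ z < ℓ m := lt_of_le_of_ne (hzle m) hmz.symm
  have hmx' : ℓ m < ℓ x := lt_of_le_of_ne (hlex m) hmx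
  set c := ℓ m
  -- truncation below and above the intermediate value splits the trace-free part of `ℓ`
  set f : Fin n → ℝ := fun i => min (ℓ i) c with hf
  set g : Fin n → ℝ := fun i => max (ℓ i) c with hg
  set u : Fin n → ℝ := fun i => f i - (∑ j, f j) / n with hu
  set w : Fin n → ℝ := fun i => g i - (∑ j, g j) / n with hw
  have humono : Monotone u := fun i j hij =>
    sub_le_sub_right (min_le_min_right c (hmono hij)) _
  have hwmono : Monotone w := fun i j hij =>
    sub_le_sub_right (max_le_max_right c (hmono hij)) _
  have husum : ∑ i, u i = 0 := sum_sub_mean_eq_zero hn0 f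
  have hwsum : ∑ i, w i = 0 := sum_sub_mean_eq_zero hn0 g
  have huw : ∀ i, u i + w i = ℓ i - 1 / n := fun i => by
    have hfg : ∑ j, f j + ∑ j, g j = 1 + n * c := by
      rw [← Finset.sum_add_distrib, Finset.sum_congr rfl fun j _ => min_add_max (ℓ j) c,
        Finset.sum_add_distrib, h1]
      simp
    have h : u i + w i = (min (ℓ i) c + max (ℓ i) c) - (∑ j, f j + ∑ j, g j) / n := by
      simp only [hu, hw, hf, hg]; ring
    rw [h, hfg, min_add_max]
    field_simp
    ring
  have huz : u z ≠ u m := by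
    simp only [hu, hf]
    rw [min_eq_left hzm.le, min_self]
    intro h; linarith
  have hum : u m = u x := by
    simp only [hu, hf]
    rw [min_eq_right hmx'.le, min_self]
  have hwm : w m ≠ w x := by
    simp only [hw, hg]
    rw [max_eq_left hmx'.le, max_self]
    intro h; linarith
  obtain ⟨s, hs, hs2⟩ := exists_norm_pos_of_ne huz
  obtain ⟨t, ht, ht2⟩ := exists_norm_pos_of_ne hwm
  obtain ⟨r, hr, hr2⟩ := exists_norm_pos_of_ne (u := fun i => u i + w i) (j := z) (k := x) (by
    simp only [huw]
    exact fun h => hne (by linarith))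
  have hr2' : r ^ 2 = 1 - 1 / n := by
    rw [← hr2]
    have key : ∀ i, (u i + w i) ^ 2 = ℓ i ^ 2 - 2 / n * ℓ i + 1 / (n : ℝ) ^ 2 :=
      fun i => by rw [huw]; ring
    simp only [key]
    rw [Finset.sum_add_distrib, Finset.sum_sub_distrib, ← Finset.mul_sum, h1, h2]
    simp only [Finset.sum_const, Finset.card_univ, Fintype.card_fin, nsmul_eq_mul]
    field_simp
    ring
  have hrst : r < s + t := norm_lt_add_of_ne hs ht hr2 hs2 ht2 hum hwm
  have hbu := hmax _ (mem_kasnerSet_of_trace_free hn0 humono husum hr.le hs hr2' hs2)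
  have hbw := hmax _ (mem_kasnerSet_of_trace_free hn0 hwmono hwsum hr.le ht hr2' ht2)
  set L := ℓ z - ℓ y - ℓ x + 1 / (n : ℝ)
  have hLneg : L < 0 := by linarith [hzle y]
  have hu' : r * (u z - u y - u x) ≤ L * s := by
    rw [← div_le_iff₀ hs]
    have : r * (u z - u y - u x) / s = r / s * u z - r / s * u y - r / s * u x := by ring
    linarith
  have hw' : r * (w z - w y - w x) ≤ L * t := by
    rw [← div_le_iff₀ ht]
    have : r * (w z - w y - w x) / t = r / t * w z - r / t * w y - r / t * w x := by ring
    linarith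
  have hLsum : (u z - u y - u x) + (w z - w y - w x) = L := by
    linarith [huw z, huw y, huw x]
  have hrL : r * L ≤ L * (s + t) := by rw [← hLsum] at hu' hw' ⊢; linarith
  nlinarith
end

section
/- Let n ≥ 2 and let k, m ≥ 1 be integers with k + m = n. Suppose x, y ∈ ℝ satisfy k·x + m·y = 1, k·x² + m·y² = 1 and x < 0. Then necessarily x = (1/n)·(1 − √(m(n−1)/k)) and y = (1/n)·(1 + √(k(n−1)/m)). -/
/-- The two Kasner relations for a vector with values `x`, `y` of multiplicities `a`, `b` yield a
quadratic equation for `x`, here in completed-square form. -/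
theorem kasner_quadratic {a b x y : ℝ} (h1 : a * x + b * y = 1)
    (h2 : a * x ^ 2 + b * y ^ 2 = 1) :
    a * (1 - (a + b) * x) ^ 2 = b * (a + b - 1) := by
  linear_combination (a + b) * (b * h2 - (b * y + 1 - a * x) * h1)

/-- Let `n ≥ 2` and `k, m ≥ 1` with `k + m = n`. If `x, y ∈ ℝ` satisfy
`k·x + m·y = 1`, `k·x² + m·y² = 1` and `x < 0`, then necessarily
`x = (1/n)(1 - √(m(n-1)/k))` and `y = (1/n)(1 + √(k(n-1)/m))`. -/
theorem kasner_two_valued_unique (n k m : ℕ) (hn : 2 ≤ n) (hk : 1 ≤ k) (hm : 1 ≤ m)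
    (hkm : k + m = n) (x y : ℝ)
    (h1 : (k : ℝ) * x + (m : ℝ) * y = 1)
    (h2 : (k : ℝ) * x ^ 2 + (m : ℝ) * y ^ 2 = 1)
    (hx : x < 0) :
    x = (1 / (n : ℝ)) * (1 - Real.sqrt ((m * ((n : ℝ) - 1)) / k)) ∧
    y = (1 / (n : ℝ)) * (1 + Real.sqrt ((k * ((n : ℝ) - 1)) / m)) := by
  have hk0 : (0 : ℝ) < k := by exact_mod_cast hk
  have hm0 : (0 : ℝ) < m := by exact_mod_cast hm
  have hn0 : (n : ℝ) = k + m := by exact_mod_cast hkm.symm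
  have hnpos : (0 : ℝ) < n := by rw [hn0]; positivity
  have hkx : (k : ℝ) * x < 0 := mul_neg_of_pos_of_neg hk0 hx
  have hy : 0 < y := pos_of_mul_pos_right (by linarith : 0 < (m : ℝ) * y) hm0.le
  have hny : 0 ≤ (n : ℝ) * y - 1 := by
    rw [hn0]
    nlinarith [mul_pos hk0 hy]
  have hnx : 0 ≤ 1 - (n : ℝ) * x := by nlinarith
  have hsx : Real.sqrt ((m * ((n : ℝ) - 1)) / k) = 1 - n * x := by
    rw [← Real.sqrt_sq hnx]
    congr 1
    rw [div_eq_iff hk0.ne', hn0]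
    linear_combination -kasner_quadratic h1 h2
  have hsy : Real.sqrt ((k * ((n : ℝ) - 1)) / m) = n * y - 1 := by
    rw [← Real.sqrt_sq hny]
    congr 1
    rw [div_eq_iff hm0.ne', hn0]
    linear_combination -kasner_quadratic ((add_comm _ _).trans h1) ((add_comm _ _).trans h2)
  rw [hsx, hsy]
  constructor <;> field_simp <;> ring
end

section
/- The vector ℓ ∈ ℝ⁹ whose first three entries equal −1/3 and whose last six entries equal 1/3 belongs to K_o(9) and satisfies F(ℓ) = 0; moreover F(ℓ') ≤ F(ℓ) = 0 for every ℓ' ∈ K_o(9), so ℓ maximizes F on K_o(9). -/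
/-- The scalar inequality behind the bound: `a`, `u`, `v` stand for the smallest and the two
largest entries. -/
lemma one_add_le_of_kasner_bound {a u v : ℝ} (ha : a ≤ 0) (hau : a ≤ u) (huv : u ≤ v)
    (h : (1 - v ^ 2) - (a + u) * (1 - v) + 8 * (a * u) ≤ 0) : a - u - v + 1 ≤ 0 := by
  by_contra! hs
  obtain ⟨s, hsv⟩ : ∃ s, v = 1 + a - u - s := ⟨1 + a - u - v, by ring⟩
  obtain ⟨b, rfl⟩ : ∃ b, a = -b := ⟨-a, by ring⟩
  subst hsv
  have hb : 0 ≤ b := by linarith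
  have hs0 : 0 < s := by linarith
  have hq : 0 ≤ u + b := by linarith
  have hp : 0 ≤ (1 - b - s) / 2 - u := by linarith
  have hleft : 0 < s * (2 + 2 * b - s) + 8 * b ^ 2 := by
    have : 0 < s * (2 + 2 * b - s) := mul_pos hs0 (by linarith)
    positivity
  have hright : 0 < (3 * b - 1) ^ 2 / 2 + s * ((1 + b) / 2 + 4 * b) := by positivity
  have hG : (u + b + s) * (2 - 2 * u - s) - 8 * b * u ≤ 0 := by linarith
  have hinterp : ((1 + b - s) / 2) * ((u + b + s) * (2 - 2 * u - s) - 8 * b * u) =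
      ((1 - b - s) / 2 - u) * (s * (2 + 2 * b - s) + 8 * b ^ 2) +
      (u + b) * ((3 * b - 1) ^ 2 / 2 + s * ((1 + b) / 2 + 4 * b)) +
      2 * ((1 - b - s) / 2 - u) * (u + b) * ((1 + b - s) / 2) := by ring
  have hneg := mul_nonpos_of_nonneg_of_nonpos (show 0 ≤ (1 + b - s) / 2 by linarith) hG
  have h₁ := mul_nonneg hp hleft.le
  have h₂ := mul_nonneg hq hright.le
  have h₃ := mul_nonneg (mul_nonneg (mul_nonneg zero_le_two hp) hq)
    (show 0 ≤ (1 + b - s) / 2 by linarith)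
  have hq0 : u + b = 0 :=
    (mul_eq_zero.mp (le_antisymm (by linarith) h₂)).resolve_right hright.ne'
  obtain rfl : u = -b := by linarith
  linarith

/-- The vector in `ℝ⁹` whose first three entries equal `-1/3` and whose last six
entries equal `1/3` belongs to `K_o(9)`, satisfies `F(ℓ) = ℓ₁ - ℓ₈ - ℓ₉ + 1 = 0`, and
maximizes `F` on `K_o(9)`: `F(ℓ') ≤ 0` for every `ℓ' ∈ K_o(9)`. -/
theorem kasner_nine_dim_maximizer (ℓ : Fin 9 → ℝ)
    (hℓ : ℓ = fun i : Fin 9 => if (i : ℕ) < 3 then (-1/3 : ℝ) else 1/3) :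
    ℓ ∈ KasnerSet 9 ∧ ℓ 0 - ℓ 7 - ℓ 8 + 1 = 0 ∧
      ∀ ℓ' ∈ KasnerSet 9, ℓ' 0 - ℓ' 7 - ℓ' 8 + 1 ≤ 0 := by
  subst hℓ
  refine ⟨⟨?_, ?_, ?_⟩, ?_, ?_⟩
  · intro i j hij
    have : (i : ℕ) ≤ j := hij
    dsimp only
    split_ifs <;> first | omega | norm_num
  · norm_num [Fin.sum_univ_succ]
  · norm_num [Fin.sum_univ_succ]
  · norm_num
  · rintro x ⟨hmono, hsum, hsq⟩
    have hmin : ∀ i, x 0 ≤ x i := fun i => hmono (Fin.zero_le i)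
    have hle_one : ∀ i, x i ≤ 1 := fun i => by
      have := Finset.single_le_sum (fun j _ => sq_nonneg (x j)) (Finset.mem_univ i)
      nlinarith
    have hneg : x 0 ≤ 0 := by
      by_contra! hpos
      have hnonneg : ∀ i, 0 ≤ x i - x i ^ 2 := fun i => by
        nlinarith [hmin i, hle_one i]
      have hzero := Finset.single_le_sum (fun j _ => hnonneg j) (Finset.mem_univ 0)
      rw [Finset.sum_sub_distrib, hsum, hsq] at hzero
      have hcard := Finset.sum_le_sum (fun i (_ : i ∈ Finset.univ) => hmin i)
      simp only [Finset.sum_const, Finset.card_univ, Fintype.card_fin, nsmul_eq_mul,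
        hsum] at hcard
      push_cast at hcard
      nlinarith
    refine one_add_le_of_kasner_bound hneg (hmin 7) (hmono (by decide)) ?_
    have hprod : ∑ i : Fin 8, (x i.castSucc - x 0) * (x i.castSucc - x 7) ≤ 0 :=
      Finset.sum_nonpos fun i _ => mul_nonpos_of_nonneg_of_nonpos
        (sub_nonneg.mpr (hmin _))
        (sub_nonpos.mpr (hmono (Fin.le_def.mpr (Nat.le_of_lt_succ i.isLt))))
    have hexpand : ∑ i : Fin 8, (x i.castSucc - x 0) * (x i.castSucc - x 7) =
        ∑ i : Fin 8, x i.castSucc ^ 2 - (x 0 + x 7) * ∑ i : Fin 8, x i.castSucc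
          + 8 * (x 0 * x 7) := by
      rw [Finset.mul_sum, ← Finset.sum_sub_distrib]
      have : (8 : ℝ) * (x 0 * x 7) = ∑ _i : Fin 8, x 0 * x 7 := by simp
      rw [this, ← Finset.sum_add_distrib]
      exact Finset.sum_congr rfl fun i _ => by ring
    rw [Fin.sum_univ_castSucc] at hsum hsq
    have hlast : Fin.last 8 = (8 : Fin 9) := rfl
    rw [hlast] at hsum hsq
    rw [hexpand, eq_sub_of_add_eq hsum, eq_sub_of_add_eq hsq] at hprod
    exact hprod
end

section
/- For every integer k ≥ 0, the energy function τ ↦ ∫₀^{2π} [ (∂_θ^k ∂_τ P(θ,τ))² + e^{−2τ} (∂_θ^{k+1} P(θ,τ))² ] dθ is non-increasing on [0,∞). -/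
open Real

open Set MeasureTheory

/-- The directional derivative of `G` in direction `v`, as a function of the base point. -/
noncomputable def dirDeriv (v : ℝ × ℝ) (G : ℝ × ℝ → ℝ) (p : ℝ × ℝ) : ℝ :=
  fderiv ℝ G p v

lemma ContDiff.dirDeriv {G : ℝ × ℝ → ℝ} (hG : ContDiff ℝ (⊤ : ℕ∞) G) (v : ℝ × ℝ) :
    ContDiff ℝ (⊤ : ℕ∞) (dirDeriv v G) :=
  (hG.fderiv_right (m := (⊤ : ℕ∞)) (by simp)).clm_apply contDiff_const

lemma ContDiff.hasDerivAt_fst {G : ℝ × ℝ → ℝ} (hG : ContDiff ℝ (⊤ : ℕ∞) G) (s t : ℝ) :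
    HasDerivAt (fun s => G (s, t)) (_root_.dirDeriv (1, 0) G (s, t)) s :=
  (hG.differentiable (by simp) (s, t)).hasFDerivAt.comp_hasDerivAt s
    ((hasDerivAt_id s).prodMk (hasDerivAt_const s t))

lemma ContDiff.hasDerivAt_snd {G : ℝ × ℝ → ℝ} (hG : ContDiff ℝ (⊤ : ℕ∞) G) (s t : ℝ) :
    HasDerivAt (fun t => G (s, t)) (_root_.dirDeriv (0, 1) G (s, t)) t :=
  (hG.differentiable (by simp) (s, t)).hasFDerivAt.comp_hasDerivAt t
    ((hasDerivAt_const t s).prodMk (hasDerivAt_id t))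

lemma dirDeriv_comm {G : ℝ × ℝ → ℝ} (hG : ContDiff ℝ (⊤ : ℕ∞) G) (v w : ℝ × ℝ) :
    dirDeriv v (dirDeriv w G) = dirDeriv w (dirDeriv v G) := by
  have key (a b p : ℝ × ℝ) :
      dirDeriv a (dirDeriv b G) p = fderiv ℝ (fderiv ℝ G) p a b := by
    have hd : DifferentiableAt ℝ (fderiv ℝ G) p :=
      (hG.fderiv_right (m := (⊤ : ℕ∞)) (by simp)).differentiable (by simp) p
    have h := hd.hasFDerivAt.clm_apply (hasFDerivAt_const b p)
    change fderiv ℝ (fun q => fderiv ℝ G q b) p a = _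
    rw [h.fderiv]
    simp
  funext p
  rw [key, key]
  refine (hG.contDiffAt (x := p)).isSymmSndFDerivAt ?_ v w
  rw [minSmoothness_of_isRCLikeNormedField]
  exact WithTop.coe_le_coe.2 (le_top : (2 : ℕ∞) ≤ ⊤)

lemma dirDeriv_periodic {G : ℝ × ℝ → ℝ} {c : ℝ × ℝ} (hG : Function.Periodic G c)
    (v : ℝ × ℝ) : Function.Periodic (dirDeriv v G) c := by
  intro p
  unfold dirDeriv
  rw [← fderiv_comp_add_right, funext hG]

/-- The polarised Gowdy equation on `τ ≥ 0` for a function of `(θ, τ)`. -/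
def IsGowdySolution (G : ℝ × ℝ → ℝ) : Prop :=
  ∀ θ τ : ℝ, 0 ≤ τ → dirDeriv (0, 1) (dirDeriv (0, 1) G) (θ, τ) =
    exp (-2 * τ) * dirDeriv (1, 0) (dirDeriv (1, 0) G) (θ, τ)

lemma IsGowdySolution.dirDeriv_fst {G : ℝ × ℝ → ℝ} (h : IsGowdySolution G)
    (hG : ContDiff ℝ (⊤ : ℕ∞) G) : IsGowdySolution (dirDeriv (1, 0) G) := by
  intro θ τ hτ
  rw [dirDeriv_comm hG (0, 1), dirDeriv_comm (hG.dirDeriv _) (0, 1)]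
  have h₁ := ((hG.dirDeriv (0, 1)).dirDeriv (0, 1)).hasDerivAt_fst θ τ
  have h₂ := (((hG.dirDeriv (1, 0)).dirDeriv (1, 0)).hasDerivAt_fst θ τ).const_mul
    (exp (-2 * τ))
  rw [funext fun s => h s τ hτ] at h₁
  exact h₁.unique h₂

lemma antitoneOn_integral_of_deriv_integral_nonpos {e e' : ℝ → ℝ → ℝ} {a b : ℝ} {c : ℝ}
    (he : Continuous fun p : ℝ × ℝ => e p.1 p.2)
    (he' : Continuous fun p : ℝ × ℝ => e' p.1 p.2)
    (hd : ∀ θ τ, HasDerivAt (e θ) (e' θ τ) τ)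
    (hneg : ∀ τ, c ≤ τ → ∫ θ in a..b, e' θ τ ≤ 0) :
    AntitoneOn (fun τ => ∫ θ in a..b, e θ τ) (Ici c) := by
  intro x hx y _ hxy
  have hi (τ : ℝ) : IntervalIntegrable (fun θ => e θ τ) volume a b :=
    Continuous.intervalIntegrable (he.comp (by fun_prop : Continuous fun θ : ℝ => (θ, τ))) _ _
  have hsub : (∫ θ in a..b, e θ y) - ∫ θ in a..b, e θ x =
      ∫ τ in x..y, ∫ θ in a..b, e' θ τ := by
    rw [← intervalIntegral.integral_sub (hi y) (hi x), ← intervalIntegral_intervalIntegral_swap]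
    · refine intervalIntegral.integral_congr fun θ _ => ?_
      refine (intervalIntegral.integral_eq_sub_of_hasDerivAt (fun τ _ => hd θ τ) ?_).symm
      exact Continuous.intervalIntegrable
        (he'.comp (by fun_prop : Continuous fun τ : ℝ => (θ, τ))) _ _
    · exact (he'.continuousOn.integrableOn_compact
        (isCompact_uIcc.prod isCompact_uIcc)).mono_set
        (prod_mono uIoc_subset_uIcc uIoc_subset_uIcc)
  have hle : ∫ τ in x..y, ∫ θ in a..b, e' θ τ ≤ 0 := by
    have := intervalIntegral.integral_nonneg (μ := volume) hxy
      (f := fun τ => -∫ θ in a..b, e' θ τ)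
      fun τ hτ => neg_nonneg.2 (hneg τ (le_trans hx hτ.1))
    rw [intervalIntegral.integral_neg] at this
    linarith
  change (∫ θ in a..b, e θ y) ≤ ∫ θ in a..b, e θ x
  linarith

lemma IsGowdySolution.antitoneOn_energy {G : ℝ × ℝ → ℝ} (h : IsGowdySolution G)
    (hG : ContDiff ℝ (⊤ : ℕ∞) G) {L : ℝ} (hL : 0 ≤ L) (hper : Function.Periodic G (L, 0)) :
    AntitoneOn (fun τ => ∫ θ in (0 : ℝ)..L,
      ((dirDeriv (0, 1) G (θ, τ)) ^ 2 + exp (-2 * τ) * (dirDeriv (1, 0) G (θ, τ)) ^ 2))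
      (Ici 0) := by
  have hT := hG.dirDeriv (0, 1)
  have hX := hG.dirDeriv (1, 0)
  have cT := hT.continuous
  have cX := hX.continuous
  have cTT := (hT.dirDeriv (0, 1)).continuous
  have cTX := (hX.dirDeriv (0, 1)).continuous
  have cXX := (hX.dirDeriv (1, 0)).continuous
  refine antitoneOn_integral_of_deriv_integral_nonpos
    (e := fun θ τ => (dirDeriv (0, 1) G (θ, τ)) ^ 2 +
      exp (-2 * τ) * (dirDeriv (1, 0) G (θ, τ)) ^ 2)
    (e' := fun θ τ => 2 * dirDeriv (0, 1) G (θ, τ) * dirDeriv (0, 1) (dirDeriv (0, 1) G) (θ, τ) +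
      (-2 * exp (-2 * τ) * (dirDeriv (1, 0) G (θ, τ)) ^ 2 + exp (-2 * τ) *
        (2 * dirDeriv (1, 0) G (θ, τ) * dirDeriv (0, 1) (dirDeriv (1, 0) G) (θ, τ))))
    (by fun_prop) (by fun_prop) ?_ ?_
  · intro θ τ
    have hexp : HasDerivAt (fun t : ℝ => exp (-2 * t)) (-2 * exp (-2 * τ)) τ := by
      simpa [mul_comm] using ((hasDerivAt_id τ).const_mul (-2)).exp
    exact (((hT.hasDerivAt_snd θ τ).fun_pow 2).fun_add
      (hexp.fun_mul ((hX.hasDerivAt_snd θ τ).fun_pow 2))).congr_deriv (by simp)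
  · intro τ hτ
    let f : ℝ → ℝ := fun θ => 2 * exp (-2 * τ) *
      (dirDeriv (0, 1) (dirDeriv (1, 0) G) (θ, τ) * dirDeriv (1, 0) G (θ, τ) +
        dirDeriv (0, 1) G (θ, τ) * dirDeriv (1, 0) (dirDeriv (1, 0) G) (θ, τ))
    have hf : IntervalIntegrable f volume 0 L :=
      Continuous.intervalIntegrable (by fun_prop) _ _
    have hg : IntervalIntegrable
        (fun θ => 2 * exp (-2 * τ) * (dirDeriv (1, 0) G (θ, τ)) ^ 2) volume 0 L :=
      Continuous.intervalIntegrable (by fun_prop) _ _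
    have hzero : ∫ θ in (0 : ℝ)..L, f θ = 0 := by
      have hd (θ : ℝ) : HasDerivAt (fun s => 2 * exp (-2 * τ) *
          (dirDeriv (0, 1) G (s, τ) * dirDeriv (1, 0) G (s, τ))) (f θ) θ := by
        have := ((hT.hasDerivAt_fst θ τ).mul (hX.hasDerivAt_fst θ τ)).const_mul
          (2 * exp (-2 * τ))
        rwa [dirDeriv_comm hG (1, 0) (0, 1)] at this
      rw [intervalIntegral.integral_eq_sub_of_hasDerivAt (fun θ _ => hd θ) hf]
      have p₁ := dirDeriv_periodic hper (0, 1) (0, τ)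
      have p₂ := dirDeriv_periodic hper (1, 0) (0, τ)
      simp only [Prod.mk_add_mk, zero_add, add_zero] at p₁ p₂
      rw [p₁, p₂, sub_self]
    have hpos : 0 ≤ ∫ θ in (0 : ℝ)..L,
        2 * exp (-2 * τ) * (dirDeriv (1, 0) G (θ, τ)) ^ 2 :=
      intervalIntegral.integral_nonneg hL fun θ _ => by positivity
    calc _ = ∫ θ in (0 : ℝ)..L,
          (f θ - 2 * exp (-2 * τ) * (dirDeriv (1, 0) G (θ, τ)) ^ 2) := by
          refine intervalIntegral.integral_congr fun θ _ => ?_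
          simp only [f, h θ τ hτ]
          ring
      _ ≤ 0 := by
          rw [intervalIntegral.integral_sub hf hg, hzero]
          linarith

lemma IsGowdySolution.antitoneOn_higher_energy (k : ℕ) {G : ℝ × ℝ → ℝ}
    (h : IsGowdySolution G) (hG : ContDiff ℝ (⊤ : ℕ∞) G) {L : ℝ} (hL : 0 ≤ L)
    (hper : Function.Periodic G (L, 0)) :
    AntitoneOn (fun τ => ∫ θ in (0 : ℝ)..L,
      ((iteratedDeriv k (fun s => dirDeriv (0, 1) G (s, τ)) θ) ^ 2 +
        exp (-2 * τ) * (iteratedDeriv (k + 1) (fun s => G (s, τ)) θ) ^ 2))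
      (Ici 0) := by
  induction k generalizing G with
  | zero =>
    simpa only [zero_add, iteratedDeriv_zero, iteratedDeriv_one,
      (hG.hasDerivAt_fst _ _).deriv] using h.antitoneOn_energy hG hL hper
  | succ k ih =>
    have h₁ (τ : ℝ) : deriv (fun s => dirDeriv (0, 1) G (s, τ)) =
        fun s => dirDeriv (0, 1) (dirDeriv (1, 0) G) (s, τ) := by
      funext s
      rw [((hG.dirDeriv (0, 1)).hasDerivAt_fst s τ).deriv, dirDeriv_comm hG]
    have h₂ (τ : ℝ) : deriv (fun s => G (s, τ)) = fun s => dirDeriv (1, 0) G (s, τ) :=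
      funext fun s => (hG.hasDerivAt_fst s τ).deriv
    have e₁ (τ θ : ℝ) : iteratedDeriv (k + 1) (fun s => dirDeriv (0, 1) G (s, τ)) θ =
        iteratedDeriv k (fun s => dirDeriv (0, 1) (dirDeriv (1, 0) G) (s, τ)) θ := by
      rw [iteratedDeriv_succ', h₁]
    have e₂ (τ θ : ℝ) : iteratedDeriv (k + 1 + 1) (fun s => G (s, τ)) θ =
        iteratedDeriv (k + 1) (fun s => dirDeriv (1, 0) G (s, τ)) θ := by
      rw [iteratedDeriv_succ', h₂]
    simp only [e₁, e₂]
    exact ih (h.dirDeriv_fst hG) (hG.dirDeriv _) (dirDeriv_periodic hper _)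

/-- Polarised T³-Gowdy: if `P` is smooth, `2π`-periodic in `θ`, and satisfies
`∂_τ² P = e^{-2τ} ∂_θ² P` for `τ ≥ 0`, then for every `k ≥ 0` the energy
`τ ↦ ∫₀^{2π} ( (∂_θ^k ∂_τ P)² + e^{-2τ} (∂_θ^{k+1} P)² ) dθ`
is non-increasing on `[0, ∞)`. -/
theorem gowdy_energy_monotone (P : ℝ → ℝ → ℝ)
    (hP : ContDiff ℝ (⊤ : ℕ∞) (fun p : ℝ × ℝ => P p.1 p.2))
    (hper : ∀ θ τ : ℝ, P (θ + 2 * π) τ = P θ τ)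
    (heq : ∀ θ τ : ℝ, 0 ≤ τ →
      iteratedDeriv 2 (fun t => P θ t) τ =
        Real.exp (-2 * τ) * iteratedDeriv 2 (fun s => P s τ) θ)
    (k : ℕ) :
    AntitoneOn (fun τ => ∫ θ in (0:ℝ)..(2 * π),
      ((iteratedDeriv k (fun s => deriv (fun t => P s t) τ) θ) ^ 2 +
        Real.exp (-2 * τ) * (iteratedDeriv (k + 1) (fun s => P s τ) θ) ^ 2))
      (Set.Ici 0) := by
  have hper' : Function.Periodic (fun p : ℝ × ℝ => P p.1 p.2) (2 * π, 0) := by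
    rintro ⟨θ, τ⟩
    simpa using hper θ τ
  have hT (θ : ℝ) : deriv (fun t => P θ t) =
      fun t => dirDeriv (0, 1) (fun p : ℝ × ℝ => P p.1 p.2) (θ, t) :=
    funext fun t => (hP.hasDerivAt_snd θ t).deriv
  have hX (τ : ℝ) : deriv (fun s => P s τ) =
      fun s => dirDeriv (1, 0) (fun p : ℝ × ℝ => P p.1 p.2) (s, τ) :=
    funext fun s => (hP.hasDerivAt_fst s τ).deriv
  have hsol : IsGowdySolution (fun p : ℝ × ℝ => P p.1 p.2) := by
    intro θ τ hτ
    have := heq θ τ hτ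
    rwa [iteratedDeriv_succ (n := 1), iteratedDeriv_succ (n := 1), iteratedDeriv_one,
      iteratedDeriv_one, hT, hX,
      ((hP.dirDeriv (0, 1)).hasDerivAt_snd θ τ).deriv,
      ((hP.dirDeriv (1, 0)).hasDerivAt_fst θ τ).deriv] at this
  simpa only [hT] using hsol.antitoneOn_higher_energy k hP (by positivity) hper'
end

section
/- For every integer k ≥ 0 there is a constant C_k > 0 (depending on P and k) such that |∂_θ^k ∂_τ P(θ,τ)| ≤ C_k for all θ ∈ ℝ and all τ ≥ 0; i.e., ∂_τ P is uniformly bounded in every C^k norm. -/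
open Real

/-- Partial derivative in the first variable. -/
noncomputable def partialFst (F : ℝ → ℝ → ℝ) (s t : ℝ) : ℝ := deriv (fun x => F x t) s

/-- Partial derivative in the second variable. -/
noncomputable def partialSnd (F : ℝ → ℝ → ℝ) (s t : ℝ) : ℝ := deriv (fun y => F s y) t

/-- Joint smoothness of a function of two real variables. -/
def JointlySmooth (F : ℝ → ℝ → ℝ) : Prop :=
  ContDiff ℝ (⊤ : ℕ∞) (fun p : ℝ × ℝ => F p.1 p.2)

namespace JointlySmooth

variable {F : ℝ → ℝ → ℝ}

lemma hasDerivAt_fst_fderiv (hF : JointlySmooth F) (s t : ℝ) :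
    HasDerivAt (fun x => F x t) (fderiv ℝ (fun p : ℝ × ℝ => F p.1 p.2) (s, t) (1, 0)) s := by
  have h := (ContDiff.differentiable hF (by simp) (s, t)).hasFDerivAt
  exact h.comp_hasDerivAt (f := fun x : ℝ => (x, t)) s
    ((hasDerivAt_id s).prodMk (hasDerivAt_const s t))

lemma hasDerivAt_snd_fderiv (hF : JointlySmooth F) (s t : ℝ) :
    HasDerivAt (fun y => F s y) (fderiv ℝ (fun p : ℝ × ℝ => F p.1 p.2) (s, t) (0, 1)) t := by
  have h := (ContDiff.differentiable hF (by simp) (s, t)).hasFDerivAt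
  exact h.comp_hasDerivAt (f := fun y : ℝ => (s, y)) t
    ((hasDerivAt_const t s).prodMk (hasDerivAt_id t))

lemma partialFst_eq (hF : JointlySmooth F) (s t : ℝ) :
    partialFst F s t = fderiv ℝ (fun p : ℝ × ℝ => F p.1 p.2) (s, t) (1, 0) :=
  (hF.hasDerivAt_fst_fderiv s t).deriv

lemma partialSnd_eq (hF : JointlySmooth F) (s t : ℝ) :
    partialSnd F s t = fderiv ℝ (fun p : ℝ × ℝ => F p.1 p.2) (s, t) (0, 1) :=
  (hF.hasDerivAt_snd_fderiv s t).deriv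

lemma hasDerivAt_fst (hF : JointlySmooth F) (s t : ℝ) :
    HasDerivAt (fun x => F x t) (partialFst F s t) s :=
  hF.partialFst_eq s t ▸ hF.hasDerivAt_fst_fderiv s t

lemma hasDerivAt_snd (hF : JointlySmooth F) (s t : ℝ) :
    HasDerivAt (fun y => F s y) (partialSnd F s t) t :=
  hF.partialSnd_eq s t ▸ hF.hasDerivAt_snd_fderiv s t

lemma contDiff_fderiv (hF : JointlySmooth F) :
    ContDiff ℝ (⊤ : ℕ∞) (fderiv ℝ (fun p : ℝ × ℝ => F p.1 p.2)) :=
  ContDiff.fderiv_right hF (by simp)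

lemma partialFst (hF : JointlySmooth F) : JointlySmooth (partialFst F) := by
  unfold JointlySmooth
  simp only [hF.partialFst_eq]
  exact hF.contDiff_fderiv.clm_apply contDiff_const

lemma partialSnd (hF : JointlySmooth F) : JointlySmooth (partialSnd F) := by
  unfold JointlySmooth
  simp only [hF.partialSnd_eq]
  exact hF.contDiff_fderiv.clm_apply contDiff_const

lemma partialFst_partialSnd (hF : JointlySmooth F) (s t : ℝ) :
    _root_.partialFst (_root_.partialSnd F) s t
      = _root_.partialSnd (_root_.partialFst F) s t := by
  have hd := (hF.contDiff_fderiv.differentiable (by simp) (s, t))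
  have hsym : IsSymmSndFDerivAt ℝ (fun p : ℝ × ℝ => F p.1 p.2) (s, t) :=
    (ContDiff.contDiffAt hF).isSymmSndFDerivAt
      (by simp only [minSmoothness_of_isRCLikeNormedField]; exact WithTop.coe_le_coe.2 le_top)
  have e1 : (fun p : ℝ × ℝ => _root_.partialSnd F p.1 p.2)
      = fun p => fderiv ℝ (fun p : ℝ × ℝ => F p.1 p.2) p (0, 1) :=
    funext fun p => hF.partialSnd_eq p.1 p.2
  have e2 : (fun p : ℝ × ℝ => _root_.partialFst F p.1 p.2)
      = fun p => fderiv ℝ (fun p : ℝ × ℝ => F p.1 p.2) p (1, 0) :=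
    funext fun p => hF.partialFst_eq p.1 p.2
  rw [hF.partialSnd.partialFst_eq, hF.partialFst.partialSnd_eq, e1, e2,
    fderiv_clm_apply hd (differentiableAt_const _), fderiv_clm_apply hd (differentiableAt_const _)]
  simpa using hsym.eq (1, 0) (0, 1)

lemma neg (hF : JointlySmooth F) : JointlySmooth (fun s t => -F s t) :=
  ContDiff.neg hF

end JointlySmooth

lemma partialFst_periodic {F : ℝ → ℝ → ℝ} {c : ℝ} (h : ∀ s t, F (s + c) t = F s t) (s t : ℝ) :
    partialFst F (s + c) t = partialFst F s t := by
  unfold partialFst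
  rw [← deriv_comp_add_const]
  simp only [h]

lemma partialSnd_periodic {F : ℝ → ℝ → ℝ} {c : ℝ} (h : ∀ s t, F (s + c) t = F s t) (s t : ℝ) :
    partialSnd F (s + c) t = partialSnd F s t := by
  simp only [partialSnd, h]

lemma HasDerivAt.nonneg_of_le_left {g : ℝ → ℝ} {g' a b : ℝ} (hg : HasDerivAt g g' b) (hab : a < b)
    (h : ∀ t ∈ Set.Ioo a b, g t ≤ g b) : 0 ≤ g' := by
  have ht := (hasDerivWithinAt_iff_tendsto_slope' (s := Set.Iio b) (by simp)).1
    hg.hasDerivWithinAt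
  refine ge_of_tendsto ht ?_
  filter_upwards [Ioo_mem_nhdsLT hab] with t hmem
  rw [slope_def_field]
  exact div_nonneg_of_nonpos (by linarith [h t hmem]) (by linarith [hmem.2])

/-- A solution of a transport equation relaxing towards `G ≤ F` cannot attain the maximum of
`F - ε t` at a positive time. -/
lemma transport_no_max {F G : ℝ → ℝ → ℝ} (hF : JointlySmooth F) {c ε s t : ℝ} (hε : 0 < ε)
    (ht : 0 < t) (heq : partialSnd F s t = c * partialFst F s t + (G s t - F s t) / 2)
    (hG : G s t ≤ F s t)
    (hmax : ∀ x, ∀ y ∈ Set.Icc 0 t, F x y - ε * y ≤ F s t - ε * t) : False := by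
  have h1 : partialFst F s t = 0 := by
    have : IsLocalMax (fun x => F x t) s :=
      Filter.Eventually.of_forall fun x => by
        have := hmax x t ⟨ht.le, le_rfl⟩
        simpa using this
    exact this.deriv_eq_zero
  have h2 : 0 ≤ partialSnd F s t - ε * 1 :=
    ((hF.hasDerivAt_snd s t).sub ((hasDerivAt_id t).const_mul ε)).nonneg_of_le_left ht
      fun y hy => hmax s y ⟨hy.1.le, hy.2.le⟩
  rw [heq, h1] at h2
  linarith

/-- Maximum principle for a pair of coupled transport equations on a circle. -/
lemma transport_pair_bounded {A B : ℝ → ℝ → ℝ} (hA : JointlySmooth A) (hB : JointlySmooth B)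
    {a b : ℝ → ℝ} {T : ℝ} (hT : 0 < T)
    (hAper : ∀ s t, A (s + T) t = A s t) (hBper : ∀ s t, B (s + T) t = B s t)
    (hAeq : ∀ s t, 0 ≤ t → partialSnd A s t = a t * partialFst A s t + (B s t - A s t) / 2)
    (hBeq : ∀ s t, 0 ≤ t → partialSnd B s t = b t * partialFst B s t + (A s t - B s t) / 2) :
    ∃ M, ∀ s t, 0 ≤ t → max (A s t) (B s t) ≤ M := by
  have hAc : Continuous fun p : ℝ × ℝ => A p.1 p.2 := ContDiff.continuous hA
  have hBc : Continuous fun p : ℝ × ℝ => B p.1 p.2 := ContDiff.continuous hB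
  have hHc : Continuous fun p : ℝ × ℝ => max (A p.1 p.2) (B p.1 p.2) := hAc.max hBc
  obtain ⟨M, hM⟩ := (isCompact_Icc (a := (0 : ℝ)) (b := T)).bddAbove_image
    (hHc.comp (continuous_id.prodMk continuous_const : Continuous fun s : ℝ => (s, (0 : ℝ)))).continuousOn
  refine ⟨M + 1, fun s t ht => ?_⟩
  set ε := 1 / (t + 1) with hε
  have hε0 : 0 < ε := by positivity
  have hεt : ε * t ≤ 1 := by
    rw [hε, div_mul_eq_mul_div, div_le_one (by positivity)]
    linarith
  obtain ⟨⟨s₀, t₀⟩, ⟨hs₀, ht₀⟩, hmax⟩ :=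
    ((isCompact_Icc (a := (0 : ℝ)) (b := T)).prod (isCompact_Icc (a := (0 : ℝ)) (b := t))).exists_isMaxOn
      ⟨(0, 0), ⟨le_rfl, hT.le⟩, le_rfl, ht⟩
      (hHc.sub (continuous_const.mul continuous_snd : Continuous fun p : ℝ × ℝ => ε * p.2)).continuousOn
  have key : ∀ x, ∀ y ∈ Set.Icc 0 t,
      max (A x y) (B x y) - ε * y ≤ max (A s₀ t₀) (B s₀ t₀) - ε * t₀ := by
    intro x y hy
    have hper : Function.Periodic (fun x => max (A x y) (B x y)) T := fun x => by
      simp only [hAper, hBper]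
    obtain ⟨x', hx', e⟩ := hper.exists_mem_Ico₀ hT x
    have e : max (A x y) (B x y) = max (A x' y) (B x' y) := e
    rw [e]
    exact hmax (a := (x', y)) ⟨⟨hx'.1, hx'.2.le⟩, hy⟩
  change s₀ ∈ Set.Icc 0 T at hs₀
  change t₀ ∈ Set.Icc 0 t at ht₀
  rcases ht₀.1.eq_or_lt with h0 | h0
  · have h1 := key s t ⟨ht, le_rfl⟩
    rw [← h0] at h1
    have h2 : max (A s₀ 0) (B s₀ 0) ≤ M := hM ⟨s₀, hs₀, rfl⟩
    linarith
  · exfalso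
    rcases le_total (B s₀ t₀) (A s₀ t₀) with hle | hle
    · refine transport_no_max hA hε0 h0 (hAeq s₀ t₀ h0.le) hle fun x y hy => ?_
      have := key x y ⟨hy.1, hy.2.trans ht₀.2⟩
      rw [max_eq_left hle] at this
      linarith [le_max_left (A x y) (B x y)]
    · refine transport_no_max hB hε0 h0 (hBeq s₀ t₀ h0.le) hle fun x y hy => ?_
      have := key x y ⟨hy.1, hy.2.trans ht₀.2⟩
      rw [max_eq_right hle] at this
      linarith [le_max_right (A x y) (B x y)]

/-- For a sign `σ = ± 1`, the combination `∂_τ Q + σ e^{-τ} ∂_θ Q` of a solution `Q`. -/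
noncomputable def characteristicDeriv (σ : ℝ) (Q : ℝ → ℝ → ℝ) (s t : ℝ) : ℝ :=
  partialSnd Q s t + σ * Real.exp (-t) * partialFst Q s t

lemma JointlySmooth.characteristicDeriv {Q : ℝ → ℝ → ℝ} (hQ : JointlySmooth Q) (σ : ℝ) :
    JointlySmooth (characteristicDeriv σ Q) :=
  ContDiff.add hQ.partialSnd
    ((contDiff_const.mul (contDiff_snd.neg.exp)).mul hQ.partialFst)

lemma characteristicDeriv_transport {Q : ℝ → ℝ → ℝ} (hQ : JointlySmooth Q) {σ s t : ℝ}
    (hσ : σ ^ 2 = 1)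
    (heq : partialSnd (partialSnd Q) s t
      = Real.exp (-2 * t) * partialFst (partialFst Q) s t) :
    partialSnd (characteristicDeriv σ Q) s t
      = σ * Real.exp (-t) * partialFst (characteristicDeriv σ Q) s t
        + (characteristicDeriv (-σ) Q s t - characteristicDeriv σ Q s t) / 2 := by
  have hexp : HasDerivAt (fun y : ℝ => Real.exp (-y)) (Real.exp (-t) * (-1)) t :=
    (hasDerivAt_neg t).exp
  have h1 : partialSnd (characteristicDeriv σ Q) s t = _ :=
    ((hQ.partialSnd.hasDerivAt_snd s t).add
      ((hexp.const_mul σ).mul (hQ.partialFst.hasDerivAt_snd s t))).deriv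
  have h2 : partialFst (characteristicDeriv σ Q) s t = _ :=
    ((hQ.partialSnd.hasDerivAt_fst s t).add
      ((hQ.partialFst.hasDerivAt_fst s t).const_mul (σ * Real.exp (-t)))).deriv
  have he : Real.exp (-2 * t) = Real.exp (-t) ^ 2 := by
    rw [← Real.exp_nat_mul]; congr 1; push_cast; ring
  rw [h1, h2, heq, hQ.partialFst_partialSnd, he]
  unfold characteristicDeriv
  linear_combination (-(Real.exp (-t) ^ 2 * partialFst (partialFst Q) s t)) * hσ

lemma characteristicDeriv_periodic {Q : ℝ → ℝ → ℝ} {c : ℝ} (h : ∀ s t, Q (s + c) t = Q s t)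
    (σ s t : ℝ) : characteristicDeriv σ Q (s + c) t = characteristicDeriv σ Q s t := by
  simp only [characteristicDeriv, partialFst_periodic h, partialSnd_periodic h]

lemma gowdy_partialSnd_bddAbove {Q : ℝ → ℝ → ℝ} (hQ : JointlySmooth Q)
    (hper : ∀ s t, Q (s + 2 * π) t = Q s t)
    (heq : ∀ s t, 0 ≤ t → partialSnd (partialSnd Q) s t
      = Real.exp (-2 * t) * partialFst (partialFst Q) s t) :
    ∃ M, ∀ s t, 0 ≤ t → partialSnd Q s t ≤ M := by
  obtain ⟨M, hM⟩ := transport_pair_bounded (hQ.characteristicDeriv 1) (hQ.characteristicDeriv (-1))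
    (a := fun t => 1 * Real.exp (-t)) (b := fun t => -1 * Real.exp (-t)) Real.two_pi_pos
    (characteristicDeriv_periodic hper 1) (characteristicDeriv_periodic hper (-1))
    (fun s t ht => characteristicDeriv_transport hQ (by norm_num) (heq s t ht))
    (fun s t ht => by
      simpa only [neg_neg] using
        characteristicDeriv_transport hQ (σ := -1) (by norm_num) (heq s t ht))
  refine ⟨M, fun s t ht => ?_⟩
  have h := max_le_iff.1 (hM s t ht)
  unfold characteristicDeriv at h
  linarith [h.1, h.2]

lemma partialFst_neg (F : ℝ → ℝ → ℝ) :
    partialFst (fun s t => -F s t) = fun s t => -partialFst F s t := by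
  funext s t
  exact deriv.fun_neg

lemma partialSnd_neg (F : ℝ → ℝ → ℝ) :
    partialSnd (fun s t => -F s t) = fun s t => -partialSnd F s t := by
  funext s t
  exact deriv.fun_neg

lemma gowdy_abs_partialSnd_bounded {Q : ℝ → ℝ → ℝ} (hQ : JointlySmooth Q)
    (hper : ∀ s t, Q (s + 2 * π) t = Q s t)
    (heq : ∀ s t, 0 ≤ t → partialSnd (partialSnd Q) s t
      = Real.exp (-2 * t) * partialFst (partialFst Q) s t) :
    ∃ C, 0 < C ∧ ∀ s t, 0 ≤ t → |partialSnd Q s t| ≤ C := by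
  obtain ⟨M, hM⟩ := gowdy_partialSnd_bddAbove hQ hper heq
  obtain ⟨N, hN⟩ := gowdy_partialSnd_bddAbove hQ.neg (fun s t => by rw [hper])
    (fun s t ht => by
      simp only [partialSnd_neg, partialFst_neg]
      rw [heq s t ht, mul_neg])
  simp only [partialSnd_neg] at hN
  refine ⟨max 1 (max M N), by positivity, fun s t ht => abs_le'.2 ⟨?_, ?_⟩⟩
  · exact (hM s t ht).trans ((le_max_left _ _).trans (le_max_right _ _))
  · exact (hN s t ht).trans ((le_max_right _ _).trans (le_max_right _ _))

/-- The `θ`-derivative of a solution is again a solution. -/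
lemma gowdy_equation_partialFst {Q : ℝ → ℝ → ℝ} (hQ : JointlySmooth Q)
    (heq : ∀ s t, 0 ≤ t → partialSnd (partialSnd Q) s t
      = Real.exp (-2 * t) * partialFst (partialFst Q) s t) (s t : ℝ) (ht : 0 ≤ t) :
    partialSnd (partialSnd (partialFst Q)) s t
      = Real.exp (-2 * t) * partialFst (partialFst (partialFst Q)) s t := by
  have e : partialSnd (partialFst Q) = partialFst (partialSnd Q) :=
    funext₂ fun s t => (hQ.partialFst_partialSnd s t).symm
  rw [e, ← hQ.partialSnd.partialFst_partialSnd]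
  have e' : (fun x => partialSnd (partialSnd Q) x t)
      = fun x => Real.exp (-2 * t) * partialFst (partialFst Q) x t :=
    funext fun x => heq x t ht
  exact (congrArg (fun f => deriv f s) e').trans
    ((hQ.partialFst.partialFst.hasDerivAt_fst s t).const_mul _).deriv

lemma gowdy_iteratedDeriv_partialSnd_bounded (k : ℕ) {Q : ℝ → ℝ → ℝ} (hQ : JointlySmooth Q)
    (hper : ∀ s t, Q (s + 2 * π) t = Q s t)
    (heq : ∀ s t, 0 ≤ t → partialSnd (partialSnd Q) s t
      = Real.exp (-2 * t) * partialFst (partialFst Q) s t) :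
    ∃ C, 0 < C ∧ ∀ s t, 0 ≤ t → |iteratedDeriv k (fun x => partialSnd Q x t) s| ≤ C := by
  induction k generalizing Q with
  | zero => simpa only [iteratedDeriv_zero] using gowdy_abs_partialSnd_bounded hQ hper heq
  | succ k ih =>
    obtain ⟨C, hC, h⟩ := ih hQ.partialFst (partialFst_periodic hper)
      (gowdy_equation_partialFst hQ heq)
    refine ⟨C, hC, fun s t ht => ?_⟩
    have e : deriv (fun x => partialSnd Q x t) = fun x => partialSnd (partialFst Q) x t :=
      funext fun x => hQ.partialFst_partialSnd x t
    rw [iteratedDeriv_succ', e]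
    exact h s t ht

/-- Polarised T³-Gowdy: if `P` is smooth, `2π`-periodic in `θ`, and satisfies
`∂_τ² P = e^{-2τ} ∂_θ² P` for `τ ≥ 0`, then for every `k ≥ 0` there is a constant
`C_k > 0` such that `|∂_θ^k ∂_τ P(θ,τ)| ≤ C_k` for all `θ ∈ ℝ` and all `τ ≥ 0`. -/
theorem gowdy_dtau_P_bounded (P : ℝ → ℝ → ℝ)
    (hP : ContDiff ℝ (⊤ : ℕ∞) (fun p : ℝ × ℝ => P p.1 p.2))
    (hper : ∀ θ τ : ℝ, P (θ + 2 * π) τ = P θ τ)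
    (heq : ∀ θ τ : ℝ, 0 ≤ τ →
      iteratedDeriv 2 (fun t => P θ t) τ =
        Real.exp (-2 * τ) * iteratedDeriv 2 (fun s => P s τ) θ) :
    ∀ k : ℕ, ∃ C : ℝ, 0 < C ∧ ∀ θ τ : ℝ, 0 ≤ τ →
      |iteratedDeriv k (fun s => deriv (fun t => P s t) τ) θ| ≤ C := by
  intro k
  refine gowdy_iteratedDeriv_partialSnd_bounded k hP hper fun s t ht => ?_
  have h := heq s t ht
  simp only [iteratedDeriv_succ, iteratedDeriv_zero] at h
  exact h
end

section
/- For every integer k ≥ 0 there is a constant C_k > 0 (depending on P and k) such that |∂_θ^k ∂_τ² P(θ,τ)| ≤ C_k (1 + τ) e^{−2τ} for all θ ∈ ℝ and all τ ≥ 0; i.e., ∂_τ² P decays exponentially in every C^k norm. -/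
open Real

namespace Gowdy

open Set MeasureTheory Topology Function

/-- The partial derivative of `F` in its first (spatial) variable. -/
noncomputable def derivSpace (F : ℝ × ℝ → ℝ) : ℝ × ℝ → ℝ := fun p => fderiv ℝ F p (1, 0)

/-- The partial derivative of `F` in its second (time) variable. -/
noncomputable def derivTime (F : ℝ × ℝ → ℝ) : ℝ × ℝ → ℝ := fun p => fderiv ℝ F p (0, 1)

/-- `F` is smooth. -/
abbrev Smooth (F : ℝ × ℝ → ℝ) : Prop := ContDiff ℝ (⊤ : ℕ∞) F

variable {F : ℝ × ℝ → ℝ}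

theorem Smooth.derivSpace (hF : Smooth F) : Smooth (derivSpace F) :=
  (hF.fderiv_right (m := (⊤ : ℕ∞)) (by simp)).clm_apply contDiff_const

theorem Smooth.derivTime (hF : Smooth F) : Smooth (derivTime F) :=
  (hF.fderiv_right (m := (⊤ : ℕ∞)) (by simp)).clm_apply contDiff_const

theorem Smooth.hasFDerivAt (hF : Smooth F) (p : ℝ × ℝ) : HasFDerivAt F (fderiv ℝ F p) p :=
  (hF.differentiable (by simp) p).hasFDerivAt

theorem Smooth.hasDerivAt_space (hF : Smooth F) (x t : ℝ) :
    HasDerivAt (fun s => F (s, t)) (Gowdy.derivSpace F (x, t)) x :=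
  (hF.hasFDerivAt (x, t)).comp_hasDerivAt x ((hasDerivAt_id x).prodMk (hasDerivAt_const x t))

theorem Smooth.hasDerivAt_time (hF : Smooth F) (x t : ℝ) :
    HasDerivAt (fun s => F (x, s)) (Gowdy.derivTime F (x, t)) t :=
  (hF.hasFDerivAt (x, t)).comp_hasDerivAt t ((hasDerivAt_const t x).prodMk (hasDerivAt_id t))

theorem Smooth.fderiv_fderiv_apply (hF : Smooth F) (p v w : ℝ × ℝ) :
    fderiv ℝ (fun q => fderiv ℝ F q v) p w = fderiv ℝ (fderiv ℝ F) p w v := by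
  have h : DifferentiableAt ℝ (fderiv ℝ F) p :=
    (hF.fderiv_right (m := (⊤ : ℕ∞)) (by simp)).differentiable (by simp) p
  rw [fderiv_clm_apply h (differentiableAt_const v)]
  simp

theorem Smooth.derivSpace_derivTime (hF : Smooth F) :
    Gowdy.derivSpace (Gowdy.derivTime F) = Gowdy.derivTime (Gowdy.derivSpace F) := by
  funext p
  have hsymm : IsSymmSndFDerivAt ℝ F p :=
    hF.contDiffAt.isSymmSndFDerivAt <| by
      rw [minSmoothness_of_isRCLikeNormedField]
      exact WithTop.coe_le_coe.2 (le_top : (2 : ℕ∞) ≤ ⊤)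
  exact (hF.fderiv_fderiv_apply p _ _).trans
    ((hsymm _ _).trans (hF.fderiv_fderiv_apply p _ _).symm)

theorem Smooth.iterate_derivSpace (hF : Smooth F) (k : ℕ) :
    Smooth (Gowdy.derivSpace^[k] F) := by
  induction k with
  | zero => exact hF
  | succ k ih => rw [iterate_succ_apply']; exact ih.derivSpace

theorem Smooth.iteratedDeriv_space (hF : Smooth F) (k : ℕ) (x t : ℝ) :
    iteratedDeriv k (fun s => F (s, t)) x = Gowdy.derivSpace^[k] F (x, t) := by
  induction k generalizing x with
  | zero => simp
  | succ k ih =>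
    rw [iteratedDeriv_succ, funext ih, iterate_succ_apply']
    exact ((hF.iterate_derivSpace k).hasDerivAt_space x t).deriv

theorem Smooth.iteratedDeriv_two_time (hF : Smooth F) (x t : ℝ) :
    iteratedDeriv 2 (fun s => F (x, s)) t = Gowdy.derivTime (Gowdy.derivTime F) (x, t) := by
  rw [iteratedDeriv_succ, iteratedDeriv_one,
    funext fun s => (hF.hasDerivAt_time x s).deriv]
  exact (hF.derivTime.hasDerivAt_time x t).deriv

/-- Differentiation under the integral sign for a smooth integrand. -/
theorem Smooth.hasDerivAt_integral (hF : Smooth F) (a b t : ℝ) :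
    HasDerivAt (fun s => ∫ x in a..b, F (x, s))
      (∫ x in a..b, Gowdy.derivTime F (x, t)) t := by
  have hc : ∀ s : ℝ, Continuous fun x => F (x, s) := fun s => by
    have := hF.continuous
    fun_prop
  have hc' : Continuous fun x => Gowdy.derivTime F (x, t) := by
    have := hF.derivTime.continuous
    fun_prop
  obtain ⟨C, hC⟩ := (isCompact_uIcc (a := a) (b := b)).prod
    (isCompact_closedBall t 1) |>.exists_bound_of_continuousOn
      hF.derivTime.continuous.continuousOn
  refine (intervalIntegral.hasDerivAt_integral_of_dominated_loc_of_deriv_le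
    (F := fun s x => F (x, s)) (F' := fun s x => Gowdy.derivTime F (x, s))
    (bound := fun _ => C) (Metric.closedBall_mem_nhds t one_pos)
    (Filter.Eventually.of_forall fun s => (hc s).aestronglyMeasurable)
    ((hc t).intervalIntegrable _ _) hc'.aestronglyMeasurable ?_ (by simp) ?_).2
  · exact Filter.Eventually.of_forall fun x hx s hs =>
      hC (x, s) ⟨uIoc_subset_uIcc hx, hs⟩
  · exact Filter.Eventually.of_forall fun x _ s _ => hF.hasDerivAt_time x s

/-- A one-dimensional Sobolev inequality: the supremum of `g ^ 2` is controlled by the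
`H¹` norm of `g`. -/
theorem sq_le_of_integral_le {g g' : ℝ → ℝ} {L A B x : ℝ} (hL : 0 ≤ L)
    (hg : ∀ y, HasDerivAt g (g' y) y) (hg' : Continuous g')
    (hA : ∫ y in (0 : ℝ)..L, g y ^ 2 ≤ A) (hB : ∫ y in (0 : ℝ)..L, g' y ^ 2 ≤ B)
    (hx : x ∈ Icc 0 L) : L * g x ^ 2 ≤ A + L * (A + B) := by
  have hgc : Continuous g := continuous_iff_continuousAt.2 fun y => (hg y).continuousAt
  have hprod : Continuous fun y => 2 * g y * g' y := by fun_prop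
  have hK : ∫ y in (0 : ℝ)..L, |2 * g y * g' y| ≤ A + B := by
    calc ∫ y in (0 : ℝ)..L, |2 * g y * g' y|
        ≤ ∫ y in (0 : ℝ)..L, (g y ^ 2 + g' y ^ 2) := by
          refine intervalIntegral.integral_mono_on hL (hprod.abs.intervalIntegrable _ _)
            ((by fun_prop : Continuous fun y => g y ^ 2 + g' y ^ 2).intervalIntegrable _ _)
            fun y _ => abs_le.2 ⟨?_, ?_⟩
          · nlinarith [sq_nonneg (g y + g' y)]
          · nlinarith [sq_nonneg (g y - g' y)]
      _ = (∫ y in (0 : ℝ)..L, g y ^ 2) + ∫ y in (0 : ℝ)..L, g' y ^ 2 :=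
          intervalIntegral.integral_add ((hgc.pow 2).intervalIntegrable _ _)
            ((hg'.pow 2).intervalIntegrable _ _)
      _ ≤ A + B := add_le_add hA hB
  have hpt : ∀ y ∈ Icc (0 : ℝ) L, g x ^ 2 ≤ g y ^ 2 + (A + B) := by
    intro y hy
    have hftc : ∫ z in y..x, 2 * g z * g' z = g x ^ 2 - g y ^ 2 :=
      intervalIntegral.integral_eq_sub_of_hasDerivAt
        (fun z _ => by simpa using (hg z).pow 2) (hprod.intervalIntegrable _ _)
    have h1 : |∫ z in y..x, 2 * g z * g' z| ≤ |(∫ z in y..x, |2 * g z * g' z|)| :=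
      intervalIntegral.norm_integral_le_abs_integral_norm
        (f := fun z => 2 * g z * g' z)
    have h2 : |(∫ z in y..x, |2 * g z * g' z|)| ≤
        |(∫ z in (0 : ℝ)..L, |2 * g z * g' z|)| := by
      refine intervalIntegral.abs_integral_mono_interval ?_
        (Filter.Eventually.of_forall fun z => abs_nonneg _)
        (hprod.abs.intervalIntegrable _ _)
      rw [uIoc_of_le hL]
      exact Ioc_subset_Ioc (le_min hy.1 hx.1) (max_le hy.2 hx.2)
    rw [abs_of_nonneg (intervalIntegral.integral_nonneg hL fun z _ => abs_nonneg _)] at h2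
    have h3 := le_abs_self (∫ z in y..x, 2 * g z * g' z)
    linarith
  have hint := intervalIntegral.integral_mono_on hL
    (continuous_const.intervalIntegrable (μ := volume) 0 L)
    ((by fun_prop : Continuous fun y => g y ^ 2 + (A + B)).intervalIntegrable
      (μ := volume) 0 L) hpt
  rw [intervalIntegral.integral_add (f := fun y => g y ^ 2)
    ((hgc.pow 2).intervalIntegrable _ _) (continuous_const.intervalIntegrable _ _)] at hint
  simp only [intervalIntegral.integral_const, sub_zero, smul_eq_mul] at hint
  linarith

/-- Smooth spatially `2π`-periodic solutions of the polarised Gowdy equation. -/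
structure IsSolution (u : ℝ × ℝ → ℝ) : Prop where
  smooth : Smooth u
  periodic : ∀ x t : ℝ, u (x + 2 * π, t) = u (x, t)
  equation : ∀ x t : ℝ, 0 ≤ t →
    derivTime (derivTime u) (x, t) = exp (-2 * t) * derivSpace (derivSpace u) (x, t)

theorem derivSpace_periodic (hF : Smooth F)
    (hper : ∀ x t : ℝ, F (x + 2 * π, t) = F (x, t)) (x t : ℝ) :
    derivSpace F (x + 2 * π, t) = derivSpace F (x, t) := by
  have h := (hF.hasDerivAt_space (x + 2 * π) t).comp_add_const x (2 * π)
  simp only [hper] at h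
  exact h.unique (hF.hasDerivAt_space x t)

theorem derivTime_periodic (hF : Smooth F)
    (hper : ∀ x t : ℝ, F (x + 2 * π, t) = F (x, t)) (x t : ℝ) :
    derivTime F (x + 2 * π, t) = derivTime F (x, t) := by
  have h := hF.hasDerivAt_time (x + 2 * π) t
  simp only [hper] at h
  exact h.unique (hF.hasDerivAt_time x t)

/-- A continuous function with period `2π` in space is bounded at each time. -/
theorem exists_bound_of_periodic (hF : Continuous F)
    (hper : ∀ x t : ℝ, F (x + 2 * π, t) = F (x, t)) (t : ℝ) :
    ∃ C : ℝ, ∀ x : ℝ, |F (x, t)| ≤ C := by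
  obtain ⟨C, hC⟩ := (isCompact_Icc (a := (0 : ℝ)) (b := 2 * π)).exists_bound_of_continuousOn
    (f := fun x => F (x, t)) (by fun_prop)
  refine ⟨C, fun x => ?_⟩
  obtain ⟨y, hy, hxy⟩ := Periodic.exists_mem_Ico₀ (f := fun x => F (x, t))
    (fun x => hper x t) two_pi_pos x
  rw [show F (x, t) = F (y, t) from hxy]
  exact hC y (Ico_subset_Icc_self hy)

namespace IsSolution

variable {u : ℝ × ℝ → ℝ}

theorem derivSpace (hu : IsSolution u) : IsSolution (Gowdy.derivSpace u) where
  smooth := hu.smooth.derivSpace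
  periodic := derivSpace_periodic hu.smooth hu.periodic
  equation x t ht := by
    rw [← hu.smooth.derivSpace_derivTime, ← hu.smooth.derivTime.derivSpace_derivTime]
    have h := hu.smooth.derivTime.derivTime.hasDerivAt_space x t
    simp only [fun s => hu.equation s t ht] at h
    exact h.unique ((hu.smooth.derivSpace.derivSpace.hasDerivAt_space x t).const_mul _)

theorem iterate_derivSpace (hu : IsSolution u) (k : ℕ) :
    IsSolution (Gowdy.derivSpace^[k] u) := by
  induction k with
  | zero => exact hu
  | succ k ih => rw [iterate_succ_apply']; exact ih.derivSpace

/-- The energy of a solution does not increase, so the kinetic energy stays bounded. -/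
theorem exists_integral_derivTime_sq_le (hu : IsSolution u) :
    ∃ A : ℝ, ∀ t : ℝ, 0 ≤ t → ∫ x in (0 : ℝ)..2 * π, derivTime u (x, t) ^ 2 ≤ A := by
  set G : ℝ × ℝ → ℝ := fun p =>
    derivTime u p ^ 2 + exp (-2 * p.2) * Gowdy.derivSpace u p ^ 2 with hG
  have hst := hu.smooth.derivTime
  have hss := hu.smooth.derivSpace
  have hGs : Smooth G := by
    unfold Smooth at *
    fun_prop
  have hexp : ∀ t : ℝ, HasDerivAt (fun s : ℝ => exp (-2 * s)) (-2 * exp (-2 * t)) t := by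
    intro t
    have := ((hasDerivAt_id t).const_mul (-2)).exp
    simpa [mul_comm] using this
  have hflux : ∀ x t : ℝ, 0 ≤ t → HasDerivAt
      (fun s => 2 * exp (-2 * t) * (derivTime u (s, t) * Gowdy.derivSpace u (s, t)))
      (derivTime G (x, t) + 2 * exp (-2 * t) * Gowdy.derivSpace u (x, t) ^ 2) x := by
    intro x t ht
    have hGt : derivTime G (x, t) = 2 * derivTime u (x, t) * derivTime (derivTime u) (x, t)
        + (-2 * exp (-2 * t) * Gowdy.derivSpace u (x, t) ^ 2 + exp (-2 * t) *
          (2 * Gowdy.derivSpace u (x, t) * derivTime (Gowdy.derivSpace u) (x, t))) := by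
      refine (hGs.hasDerivAt_time x t).unique ?_
      have h1 := (hst.hasDerivAt_time x t).pow 2
      have h2 := (hexp t).mul ((hss.hasDerivAt_time x t).pow 2)
      refine (h1.add h2).congr_deriv ?_
      simp
    refine (((hst.hasDerivAt_space x t).mul (hss.hasDerivAt_space x t)).const_mul
      (2 * exp (-2 * t))).congr_deriv ?_
    rw [hGt, hu.equation x t ht, hu.smooth.derivSpace_derivTime]
    ring
  have hdecay : ∀ t : ℝ, 0 ≤ t → ∫ x in (0 : ℝ)..2 * π, derivTime G (x, t) ≤ 0 := by
    intro t ht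
    have hc1 : Continuous fun x => derivTime G (x, t) := by
      have := hGs.derivTime.continuous
      fun_prop
    have hc2 : Continuous fun x => 2 * exp (-2 * t) * Gowdy.derivSpace u (x, t) ^ 2 := by
      have := hss.continuous
      fun_prop
    have h := intervalIntegral.integral_eq_sub_of_hasDerivAt
      (fun x (_ : x ∈ uIcc (0 : ℝ) (2 * π)) => hflux x t ht)
      ((hc1.add hc2).intervalIntegrable _ _)
    have hp1 := derivTime_periodic hu.smooth hu.periodic 0 t
    have hp2 := derivSpace_periodic hu.smooth hu.periodic 0 t
    rw [zero_add] at hp1 hp2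
    rw [hp1, hp2, sub_self, intervalIntegral.integral_add (hc1.intervalIntegrable _ _)
      (hc2.intervalIntegrable _ _)] at h
    have : 0 ≤ ∫ x in (0 : ℝ)..2 * π, 2 * exp (-2 * t) * Gowdy.derivSpace u (x, t) ^ 2 :=
      intervalIntegral.integral_nonneg two_pi_pos.le fun x _ => by positivity
    linarith
  have hanti : AntitoneOn (fun t => ∫ x in (0 : ℝ)..2 * π, G (x, t)) (Ici 0) := by
    have hd := fun t => hGs.hasDerivAt_integral 0 (2 * π) t
    refine antitoneOn_of_deriv_nonpos (convex_Ici 0)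
      (fun t _ => (hd t).continuousAt.continuousWithinAt)
      (fun t _ => (hd t).differentiableAt.differentiableWithinAt) fun t ht => ?_
    rw [(hd t).deriv]
    exact hdecay t (interior_subset ht)
  refine ⟨∫ x in (0 : ℝ)..2 * π, G (x, 0), fun t ht =>
    le_trans ?_ (hanti self_mem_Ici ht ht)⟩
  have hc1 := hst.continuous
  have hc2 := hGs.continuous
  refine intervalIntegral.integral_mono_on two_pi_pos.le
    (Continuous.intervalIntegrable (by fun_prop) _ _)
    (Continuous.intervalIntegrable (by fun_prop) _ _) fun x _ => ?_
  simp only [hG]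
  exact le_add_of_nonneg_right (by positivity)

theorem exists_abs_derivTime_le (hu : IsSolution u) :
    ∃ C : ℝ, ∀ x t : ℝ, 0 ≤ t → |derivTime u (x, t)| ≤ C := by
  obtain ⟨A, hA⟩ := hu.exists_integral_derivTime_sq_le
  obtain ⟨B, hB⟩ := hu.derivSpace.exists_integral_derivTime_sq_le
  rw [← hu.smooth.derivSpace_derivTime] at hB
  refine ⟨√((A + 2 * π * (A + B)) / (2 * π)), fun x t ht => ?_⟩
  obtain ⟨y, hy, hxy⟩ := Periodic.exists_mem_Ico₀ (f := fun x => derivTime u (x, t))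
    (fun x => derivTime_periodic hu.smooth hu.periodic x t) two_pi_pos x
  rw [show derivTime u (x, t) = derivTime u (y, t) from hxy]
  apply abs_le_sqrt
  rw [le_div_iff₀' two_pi_pos]
  have hc := hu.smooth.derivTime.derivSpace.continuous
  exact sq_le_of_integral_le (g := fun x => derivTime u (x, t)) two_pi_pos.le
    (fun z => hu.smooth.derivTime.hasDerivAt_space z t) (by fun_prop) (hA t ht) (hB t ht)
    (Ico_subset_Icc_self hy)

/-- Solutions grow at most linearly in time. -/
theorem exists_abs_le (hu : IsSolution u) :
    ∃ C : ℝ, 0 < C ∧ ∀ x t : ℝ, 0 ≤ t → |u (x, t)| ≤ C * (1 + t) := by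
  obtain ⟨A, hA⟩ := exists_bound_of_periodic hu.smooth.continuous hu.periodic 0
  obtain ⟨B, hB⟩ := hu.exists_abs_derivTime_le
  have hA0 : 0 ≤ A := (abs_nonneg _).trans (hA 0)
  have hB0 : 0 ≤ B := (abs_nonneg _).trans (hB 0 0 le_rfl)
  refine ⟨A + B + 1, by positivity, fun x t ht => ?_⟩
  have h := (convex_Ici (0 : ℝ)).norm_image_sub_le_of_norm_hasDerivWithin_le
    (fun s _ => (hu.smooth.hasDerivAt_time x s).hasDerivWithinAt)
    (fun s hs => hB x s hs) self_mem_Ici ht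
  rw [Real.norm_eq_abs, Real.norm_eq_abs, sub_zero, abs_of_nonneg ht] at h
  have h1 := abs_sub_abs_le_abs_sub (u (x, t)) (u (x, 0))
  have h2 := hA x
  nlinarith [mul_nonneg hA0 ht]

theorem iterate_derivSpace_derivTime_derivTime (hu : IsSolution u) (k : ℕ) (x t : ℝ)
    (ht : 0 ≤ t) : Gowdy.derivSpace^[k] (derivTime (derivTime u)) (x, t) =
      exp (-2 * t) * Gowdy.derivSpace^[k + 2] u (x, t) := by
  rw [← hu.smooth.derivTime.derivTime.iteratedDeriv_space,
    funext fun s => hu.equation s t ht, iteratedDeriv_const_mul_field,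
    hu.smooth.derivSpace.derivSpace.iteratedDeriv_space]
  rfl

end IsSolution

end Gowdy

/-- Polarised T³-Gowdy: if `P` is smooth, `2π`-periodic in `θ`, and satisfies
`∂_τ² P = e^{-2τ} ∂_θ² P` for `τ ≥ 0`, then for every `k ≥ 0` there is a constant
`C_k > 0` such that `|∂_θ^k ∂_τ² P(θ,τ)| ≤ C_k (1 + τ) e^{-2τ}` for all `θ ∈ ℝ`
and all `τ ≥ 0`; i.e. `∂_τ² P` decays exponentially in every `C^k` norm. -/
theorem gowdy_dtau_sq_P_decay (P : ℝ → ℝ → ℝ)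
    (hP : ContDiff ℝ (⊤ : ℕ∞) (fun p : ℝ × ℝ => P p.1 p.2))
    (hper : ∀ θ τ : ℝ, P (θ + 2 * π) τ = P θ τ)
    (heq : ∀ θ τ : ℝ, 0 ≤ τ →
      iteratedDeriv 2 (fun t => P θ t) τ =
        Real.exp (-2 * τ) * iteratedDeriv 2 (fun s => P s τ) θ) :
    ∀ k : ℕ, ∃ C : ℝ, 0 < C ∧ ∀ θ τ : ℝ, 0 ≤ τ →
      |iteratedDeriv k (fun s => iteratedDeriv 2 (fun t => P s t) τ) θ| ≤
        C * (1 + τ) * Real.exp (-2 * τ) := by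
  intro k
  set u : ℝ × ℝ → ℝ := fun p => P p.1 p.2
  have hu : Gowdy.IsSolution u := by
    refine ⟨hP, hper, fun x t ht => ?_⟩
    rw [← Gowdy.Smooth.iteratedDeriv_two_time hP]
    exact (heq x t ht).trans (congrArg _ (Gowdy.Smooth.iteratedDeriv_space hP 2 x t))
  obtain ⟨C, hC, hbound⟩ := (hu.iterate_derivSpace (k + 2)).exists_abs_le
  refine ⟨C, hC, fun x t ht => ?_⟩
  have h : iteratedDeriv k (fun s => iteratedDeriv 2 (fun r => P s r) t) x =
      exp (-2 * t) * Gowdy.derivSpace^[k + 2] u (x, t) := by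
    rw [← hu.iterate_derivSpace_derivTime_derivTime k x t ht,
      ← hu.smooth.derivTime.derivTime.iteratedDeriv_space]
    exact congrArg (fun f => iteratedDeriv k f x)
      (funext fun s => hu.smooth.iteratedDeriv_two_time s t)
  rw [h, abs_mul, abs_of_pos (exp_pos _), mul_comm]
  exact mul_le_mul_of_nonneg_right (hbound x t ht) (exp_pos _).le
end
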